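/- For every almost homomorphism f : ℤ → ℤ, the limit r = lim_{n→∞} f(n)/n exists (as a real number), and f − f_r is bounded, where f_r(n) = ⌊rn⌋. -/

import Mathlib

/-- `f : ℤ → ℤ` is an almost homomorphism: `f (p+q) - f p - f q` has bounded range. -/
def AlmostHom (f : ℤ → ℤ) : Prop := ∃ C : ℤ, ∀ p q : ℤ, |f (p + q) - f p - f q| < C

/-- `f : ℤ → ℤ` has bounded range. -/
def Bdd (f : ℤ → ℤ) : Prop := ∃ C : ℤ, ∀ p : ℤ, |f p| < C

open Filter

/-- If `f` is additive up to an error `C`, then it is homogeneous up to an error linear in the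
multiplier. -/
theorem abs_apply_mul_sub_mul_le {f : ℤ → ℤ} {C : ℤ}
    (hC : ∀ p q : ℤ, |f (p + q) - f p - f q| < C) (m : ℤ) (k : ℕ) :
    |f ((k + 1) * m) - (k + 1) * f m| ≤ k * C := by
  induction k with
  | zero => simp
  | succ k ih =>
    have h := hC ((k + 1) * m) m
    rw [show ((k : ℤ) + 1) * m + m = (((k + 1 : ℕ) : ℤ) + 1) * m by push_cast; ring] at h
    rw [abs_lt] at h
    rw [abs_le] at ih ⊢
    generalize f ((((k + 1 : ℕ) : ℤ) + 1) * m) = x at *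
    push_cast
    constructor <;> linarith

/-- If `f` is additive up to an error `C`, then it is within `C` of a linear function on the
positive integers. -/
theorem exists_abs_apply_sub_mul_le {f : ℤ → ℤ} {C : ℤ}
    (hC : ∀ p q : ℤ, |f (p + q) - f p - f q| < C) :
    ∃ r : ℝ, ∀ n : ℕ, 0 < n → |(f n : ℝ) - r * n| ≤ C := by
  have hC0 : 0 < C := (abs_nonneg _).trans_lt (hC 0 0)
  have key (m n : ℕ) : ((f (m + 1) : ℝ) - C) / (m + 1) ≤ ((f (n + 1) : ℝ) + C) / (n + 1) := by
    have h₁ := abs_le.1 (abs_apply_mul_sub_mul_le hC (m + 1) n)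
    have h₂ := abs_le.1 (abs_apply_mul_sub_mul_le hC (n + 1) m)
    rw [mul_comm ((m : ℤ) + 1) (n + 1)] at h₂
    have h : (f (m + 1) - C) * (n + 1) ≤ (f (n + 1) + C) * (m + 1) := by linarith
    rw [div_le_div_iff₀ (by positivity) (by positivity)]
    exact_mod_cast h
  obtain ⟨r, hr₁, hr₂⟩ := exists_between_of_forall_le
    (Set.range_nonempty fun m : ℕ => ((f (m + 1) : ℝ) - C) / (m + 1))
    (Set.range_nonempty fun n : ℕ => ((f (n + 1) : ℝ) + C) / (n + 1))
    (by rintro _ ⟨m, rfl⟩ _ ⟨n, rfl⟩; exact key m n)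
  refine ⟨r, fun n hn => ?_⟩
  obtain ⟨k, rfl⟩ := Nat.exists_eq_succ_of_ne_zero hn.ne'
  have h₁ := hr₁ (Set.mem_range_self k)
  have h₂ := hr₂ (Set.mem_range_self k)
  rw [div_le_iff₀ (by positivity)] at h₁
  rw [le_div_iff₀ (by positivity)] at h₂
  push_cast
  rw [abs_le]
  constructor <;> linarith

/-- For every almost homomorphism `f`, the limit `r = lim_{n → ∞} f(n)/n` exists in `ℝ`,
and `f - f_r` is bounded, where `f_r(n) = ⌊r n⌋`. -/
theorem almostHom_slope (f : ℤ → ℤ) (hf : AlmostHom f) :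
    ∃ r : ℝ, Tendsto (fun n : ℕ => (f (n : ℤ) : ℝ) / (n : ℝ)) atTop (nhds r) ∧
      ∃ C : ℤ, ∀ n : ℤ, |f n - ⌊r * (n : ℝ)⌋| ≤ C := by
  obtain ⟨C, hC⟩ := hf
  obtain ⟨r, hr⟩ := exists_abs_apply_sub_mul_le hC
  refine ⟨r, ?_, 3 * C + 1, fun n => ?_⟩
  · rw [tendsto_iff_norm_sub_tendsto_zero]
    refine squeeze_zero' (Eventually.of_forall fun _ => norm_nonneg _) ?_
      (tendsto_const_div_atTop_nhds_zero_nat (C : ℝ))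
    filter_upwards [eventually_gt_atTop 0] with n hn
    have hn' : (0 : ℝ) < n := by exact_mod_cast hn
    rw [Real.norm_eq_abs, div_sub' hn'.ne', abs_div, abs_of_pos hn', mul_comm (n : ℝ) r]
    gcongr
    exact hr n hn
  · have h0 := abs_lt.1 (hC 0 0)
    simp only [add_zero, sub_self, zero_sub] at h0
    have h0l : -(C : ℝ) < -f 0 := by exact_mod_cast h0.1
    have h0r : -(f 0 : ℝ) < C := by exact_mod_cast h0.2
    have hlin : |(f n : ℝ) - r * n| ≤ 3 * C := by
      rw [abs_le]
      obtain ⟨k, rfl | rfl⟩ := n.eq_nat_or_neg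
      · rcases k.eq_zero_or_pos with rfl | hk
        · simp only [Nat.cast_zero, Int.cast_zero, mul_zero, sub_zero]
          constructor <;> linarith
        · have h := abs_le.1 (hr k hk)
          push_cast
          constructor <;> linarith
      · rcases k.eq_zero_or_pos with rfl | hk
        · simp only [Nat.cast_zero, neg_zero, Int.cast_zero, mul_zero, sub_zero]
          constructor <;> linarith
        · have h := abs_le.1 (hr k hk)
          have hs := abs_lt.1 (hC k (-k))
          rw [add_neg_cancel] at hs
          have hsl : -(C : ℝ) < f 0 - f k - f (-k) := by exact_mod_cast hs.1
          have hsr : (f 0 : ℝ) - f k - f (-k) < C := by exact_mod_cast hs.2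
          push_cast
          constructor <;> linarith
    have hfl := Int.floor_le (r * n)
    have hlf := Int.lt_floor_add_one (r * n)
    rw [abs_le] at hlin
    have h : |(f n : ℝ) - ⌊r * n⌋| ≤ 3 * C + 1 := by
      rw [abs_le]
      constructor <;> linarith
    exact_mod_cast h
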